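/- In a differential category in which J_R is an isomorphism, define s_R := d°_R J_R⁻¹ : !R → !R. If s_R satisfies [ftc.2], then it is the unique map !R → !R satisfying [ftc.2]. -/

import Mathlib

universe u v

/-- A symmetric strict monoidal category (data and the coherence axioms that
do not require transport along object equalities). Composition `comp f g`
is in diagrammatic order: first `f`, then `g`. -/
structure SMCData where
  Obj : Type u
  Hom : Obj → Obj → Type v
  id : ∀ A : Obj, Hom A A
  comp : ∀ {A B C : Obj}, Hom A B → Hom B C → Hom A C
  id_comp : ∀ {A B : Obj} (f : Hom A B), comp (id A) f = f
  comp_id : ∀ {A B : Obj} (f : Hom A B), comp f (id B) = f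
  comp_assoc : ∀ {A B C D : Obj} (f : Hom A B) (g : Hom B C) (h : Hom C D),
    comp (comp f g) h = comp f (comp g h)
  ten : Obj → Obj → Obj
  unit : Obj
  tHom : ∀ {A B C D : Obj}, Hom A C → Hom B D → Hom (ten A B) (ten C D)
  tHom_id : ∀ (A B : Obj), tHom (id A) (id B) = id (ten A B)
  tHom_comp : ∀ {A₁ A₂ A₃ B₁ B₂ B₃ : Obj} (f : Hom A₁ A₂) (g : Hom A₂ A₃)
    (f' : Hom B₁ B₂) (g' : Hom B₂ B₃),
    tHom (comp f g) (comp f' g') = comp (tHom f f') (tHom g g')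
  tenAssoc : ∀ (A B C : Obj), ten (ten A B) C = ten A (ten B C)
  unit_ten : ∀ (A : Obj), ten unit A = A
  ten_unit : ∀ (A : Obj), ten A unit = A
  sw : ∀ (A B : Obj), Hom (ten A B) (ten B A)
  sw_natural : ∀ {A B C D : Obj} (f : Hom A C) (g : Hom B D),
    comp (tHom f g) (sw C D) = comp (sw A B) (tHom g f)
  sw_sw : ∀ (A B : Obj), comp (sw A B) (sw B A) = id (ten A B)

/-- The identity morphism transported along an equality of objects. In a
strict monoidal category the structural isomorphisms are identities, so these
are used to express the strictness identifications. -/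
def SMCData.cHom (C : SMCData) {A B : C.Obj} (h : A = B) : C.Hom A B := by
  cases h; exact C.id A
/-- A differential category: an additive symmetric strict monoidal category with a coalgebra modality and a deriving transformation. -/
structure DiffCat extends SMCData where
  -- strictness coherence: associativity and unit identifications are
  -- (transported) identities compatible with the tensor of morphisms,
  -- and the symmetry satisfies the (strict) hexagon identity
  assoc_natural : ∀ {A₁ A₂ B₁ B₂ C₁ C₂ : Obj} (f : Hom A₁ A₂) (g : Hom B₁ B₂) (h : Hom C₁ C₂),
    comp (tHom (tHom f g) h) (toSMCData.cHom (tenAssoc A₂ B₂ C₂)) =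
      comp (toSMCData.cHom (tenAssoc A₁ B₁ C₁)) (tHom f (tHom g h))
  unit_ten_natural : ∀ {A B : Obj} (f : Hom A B),
    comp (tHom (id unit) f) (toSMCData.cHom (unit_ten B)) =
      comp (toSMCData.cHom (unit_ten A)) f
  ten_unit_natural : ∀ {A B : Obj} (f : Hom A B),
    comp (tHom f (id unit)) (toSMCData.cHom (ten_unit B)) =
      comp (toSMCData.cHom (ten_unit A)) f
  hexagon : ∀ (A B C : Obj),
    comp (toSMCData.cHom (tenAssoc A B C))
      (comp (tHom (id A) (sw B C))
        (comp (toSMCData.cHom (tenAssoc A C B).symm)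
          (comp (tHom (sw A C) (id B)) (toSMCData.cHom (tenAssoc C A B))))) =
      sw (ten A B) C
  -- additive enrichment: hom-sets are commutative monoids and composition
  -- and tensor preserve the additive structure
  add : ∀ {A B : Obj}, Hom A B → Hom A B → Hom A B
  zero : ∀ {A B : Obj}, Hom A B
  add_assoc : ∀ {A B : Obj} (f g h : Hom A B), add (add f g) h = add f (add g h)
  add_comm : ∀ {A B : Obj} (f g : Hom A B), add f g = add g f
  add_zero : ∀ {A B : Obj} (f : Hom A B), add f zero = f
  comp_add : ∀ {A B C : Obj} (f : Hom A B) (g h : Hom B C),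
    comp f (add g h) = add (comp f g) (comp f h)
  add_comp : ∀ {A B C : Obj} (f g : Hom A B) (h : Hom B C),
    comp (add f g) h = add (comp f h) (comp g h)
  comp_zero : ∀ {A B C : Obj} (f : Hom A B), comp f (zero : Hom B C) = zero
  zero_comp : ∀ {A B C : Obj} (f : Hom B C), comp (zero : Hom A B) f = zero
  tHom_add_left : ∀ {A B C D : Obj} (f g : Hom A C) (h : Hom B D),
    tHom (add f g) h = add (tHom f h) (tHom g h)
  tHom_add_right : ∀ {A B C D : Obj} (f : Hom A C) (g h : Hom B D),
    tHom f (add g h) = add (tHom f g) (tHom f h)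
  tHom_zero_left : ∀ {A B C D : Obj} (h : Hom B D),
    tHom (zero : Hom A C) h = zero
  tHom_zero_right : ∀ {A B C D : Obj} (f : Hom A C),
    tHom f (zero : Hom B D) = zero
  -- a coalgebra modality: a comonad (bang, rho, eps) with natural
  -- cocommutative comonoid structure (cmul, cunit) on each bang A,
  -- for which each rho A is a comonoid morphism
  bang : Obj → Obj
  bangMap : ∀ {A B : Obj}, Hom A B → Hom (bang A) (bang B)
  bangMap_id : ∀ (A : Obj), bangMap (id A) = id (bang A)
  bangMap_comp : ∀ {A B C : Obj} (f : Hom A B) (g : Hom B C),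
    bangMap (comp f g) = comp (bangMap f) (bangMap g)
  rho : ∀ (A : Obj), Hom (bang A) (bang (bang A))
  eps : ∀ (A : Obj), Hom (bang A) A
  cmul : ∀ (A : Obj), Hom (bang A) (ten (bang A) (bang A))
  cunit : ∀ (A : Obj), Hom (bang A) unit
  rho_natural : ∀ {A B : Obj} (f : Hom A B),
    comp (bangMap f) (rho B) = comp (rho A) (bangMap (bangMap f))
  eps_natural : ∀ {A B : Obj} (f : Hom A B),
    comp (bangMap f) (eps B) = comp (eps A) f
  cmul_natural : ∀ {A B : Obj} (f : Hom A B),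
    comp (bangMap f) (cmul B) = comp (cmul A) (tHom (bangMap f) (bangMap f))
  cunit_natural : ∀ {A B : Obj} (f : Hom A B),
    comp (bangMap f) (cunit B) = cunit A
  rho_eps : ∀ (A : Obj), comp (rho A) (eps (bang A)) = id (bang A)
  rho_bangMap_eps : ∀ (A : Obj), comp (rho A) (bangMap (eps A)) = id (bang A)
  rho_rho : ∀ (A : Obj), comp (rho A) (rho (bang A)) = comp (rho A) (bangMap (rho A))
  cmul_coassoc : ∀ (A : Obj),
    comp (cmul A) (comp (tHom (cmul A) (id (bang A)))
      (toSMCData.cHom (tenAssoc (bang A) (bang A) (bang A)))) =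
    comp (cmul A) (tHom (id (bang A)) (cmul A))
  cmul_counit_left : ∀ (A : Obj),
    comp (cmul A) (comp (tHom (cunit A) (id (bang A)))
      (toSMCData.cHom (unit_ten (bang A)))) = id (bang A)
  cmul_counit_right : ∀ (A : Obj),
    comp (cmul A) (comp (tHom (id (bang A)) (cunit A))
      (toSMCData.cHom (ten_unit (bang A)))) = id (bang A)
  cmul_cocomm : ∀ (A : Obj), comp (cmul A) (sw (bang A) (bang A)) = cmul A
  rho_cmul : ∀ (A : Obj),
    comp (rho A) (cmul (bang A)) = comp (cmul A) (tHom (rho A) (rho A))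
  rho_cunit : ∀ (A : Obj), comp (rho A) (cunit (bang A)) = cunit A
  -- a deriving transformation [d.1]-[d.5]
  der : ∀ (A : Obj), Hom (ten (bang A) A) (bang A)
  der_natural : ∀ {A B : Obj} (f : Hom A B),
    comp (tHom (bangMap f) f) (der B) = comp (der A) (bangMap f)
  -- [d.1] constant rule
  der_cunit : ∀ (A : Obj), comp (der A) (cunit A) = zero
  -- [d.2] Leibniz rule
  der_cmul : ∀ (A : Obj),
    comp (der A) (cmul A) =
      add
        (comp (tHom (cmul A) (id A))
          (comp (toSMCData.cHom (tenAssoc (bang A) (bang A) A))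
            (comp (tHom (id (bang A)) (sw (bang A) A))
              (comp (toSMCData.cHom (tenAssoc (bang A) A (bang A)).symm)
                (tHom (der A) (id (bang A)))))))
        (comp (tHom (cmul A) (id A))
          (comp (toSMCData.cHom (tenAssoc (bang A) (bang A) A))
            (tHom (id (bang A)) (der A))))
  -- [d.3] linear rule
  der_eps : ∀ (A : Obj),
    comp (der A) (eps A) = comp (tHom (cunit A) (id A)) (toSMCData.cHom (unit_ten A))
  -- [d.4] chain rule
  der_rho : ∀ (A : Obj),
    comp (der A) (rho A) =
      comp (tHom (cmul A) (id A))
        (comp (toSMCData.cHom (tenAssoc (bang A) (bang A) A))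
          (comp (tHom (rho A) (der A)) (der (bang A))))
  -- [d.5] interchange rule
  der_interchange : ∀ (A : Obj),
    comp (tHom (der A) (id A)) (der A) =
      comp (toSMCData.cHom (tenAssoc (bang A) A A))
        (comp (tHom (id (bang A)) (sw A A))
          (comp (toSMCData.cHom (tenAssoc (bang A) A A).symm)
            (comp (tHom (der A) (id A)) (der A))))

def DiffCat.cHom (C : DiffCat) {A B : C.Obj} (h : A = B) : C.Hom A B :=
  C.toSMCData.cHom h

namespace DiffCat

variable (C : DiffCat)

/-- The coderiving transformation d°_A := Δ_A (1 ⊗ ε_A). -/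
def dcirc (A : C.Obj) : C.Hom (C.bang A) (C.ten (C.bang A) A) :=
  C.comp (C.cmul A) (C.tHom (C.id (C.bang A)) (C.eps A))

/-- K_A := d°_A d_A + !(0). -/
def K (A : C.Obj) : C.Hom (C.bang A) (C.bang A) :=
  C.add (C.comp (C.dcirc A) (C.der A)) (C.bangMap (C.zero : C.Hom A A))

/-- J_A := d°_A d_A + 1_{!A}. -/
def J (A : C.Obj) : C.Hom (C.bang A) (C.bang A) :=
  C.add (C.comp (C.dcirc A) (C.der A)) (C.id (C.bang A))

/-- The deriving transformation at the monoidal unit, under the strictness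
identification !R ⊗ R = !R. -/
def dR : C.Hom (C.bang C.unit) (C.bang C.unit) :=
  C.comp (C.cHom (C.ten_unit (C.bang C.unit)).symm) (C.der C.unit)

/-- The coderiving transformation at the monoidal unit, under the strictness
identification !R ⊗ R = !R. -/
def dcircR : C.Hom (C.bang C.unit) (C.bang C.unit) :=
  C.comp (C.dcirc C.unit) (C.cHom (C.ten_unit (C.bang C.unit)))

end DiffCat

namespace SMCData

variable (C : SMCData)

theorem cHom_refl {A : C.Obj} (h : A = A) : C.cHom h = C.id A := rfl

theorem cHom_cHom {A B D : C.Obj} (h : A = B) (k : B = D) :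
    C.comp (C.cHom h) (C.cHom k) = C.cHom (h.trans k) := by
  subst h k
  exact C.id_comp _

theorem cHom_cHom_assoc {A B D E : C.Obj} (h : A = B) (k : B = D) (f : C.Hom D E) :
    C.comp (C.cHom h) (C.comp (C.cHom k) f) = C.comp (C.cHom (h.trans k)) f := by
  rw [← C.comp_assoc, cHom_cHom]

theorem tHom_cHom {A A' B B' : C.Obj} (h : A = A') (k : B = B') :
    C.tHom (C.cHom h) (C.cHom k) = C.cHom (congrArg₂ C.ten h k) := by
  subst h k
  exact C.tHom_id _ _

theorem cHom_comp_cancel {A B D : C.Obj} (h : A = B) {f g : C.Hom B D}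
    (hfg : C.comp (C.cHom h) f = C.comp (C.cHom h) g) : f = g := by
  subst h
  simpa only [cHom_refl, C.id_comp] using hfg

theorem comp_cHom_cancel {A B D : C.Obj} (h : B = D) {f g : C.Hom A B}
    (hfg : C.comp f (C.cHom h) = C.comp g (C.cHom h)) : f = g := by
  subst h
  simpa only [cHom_refl, C.comp_id] using hfg

theorem sw_comp_cancel {A B D : C.Obj} {f g : C.Hom (C.ten B A) D}
    (hfg : C.comp (C.sw A B) f = C.comp (C.sw A B) g) : f = g := by
  rw [← C.id_comp f, ← C.id_comp g, ← C.sw_sw, C.comp_assoc, C.comp_assoc, hfg]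

theorem tHom_id_comp (A : C.Obj) {B D E : C.Obj} (f : C.Hom B D) (g : C.Hom D E) :
    C.tHom (C.id A) (C.comp f g) = C.comp (C.tHom (C.id A) f) (C.tHom (C.id A) g) := by
  rw [← C.tHom_comp, C.id_comp]

/-- Transporting the first argument of the symmetry. -/
theorem sw_eq_of_eq {A A' : C.Obj} (h : A = A') (B : C.Obj) :
    C.sw A B = C.comp (C.cHom (congrArg (C.ten · B) h))
      (C.comp (C.sw A' B) (C.cHom (congrArg (C.ten B ·) h.symm))) := by
  subst h
  simp only [cHom_refl, C.id_comp, C.comp_id]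

end SMCData

namespace DiffCat

variable (C : DiffCat)

theorem tHom_id_unit_left {A B : C.Obj} (f : C.Hom A B) :
    C.tHom (C.id C.unit) f =
      C.comp (C.toSMCData.cHom (C.unit_ten A))
        (C.comp f (C.toSMCData.cHom (C.unit_ten B).symm)) := by
  apply C.comp_cHom_cancel (C.unit_ten B)
  rw [C.unit_ten_natural]
  simp only [C.comp_assoc, C.cHom_cHom, C.cHom_refl, C.comp_id]

theorem tHom_id_unit_right {A B : C.Obj} (f : C.Hom A B) :
    C.tHom f (C.id C.unit) =
      C.comp (C.toSMCData.cHom (C.ten_unit A))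
        (C.comp f (C.toSMCData.cHom (C.ten_unit B).symm)) := by
  apply C.comp_cHom_cancel (C.ten_unit B)
  rw [C.ten_unit_natural]
  simp only [C.comp_assoc, C.cHom_cHom, C.cHom_refl, C.comp_id]

/-- The symmetry with the monoidal unit on the left is the strictness identification. -/
theorem sw_unit_left (A : C.Obj) :
    C.sw C.unit A = C.toSMCData.cHom ((C.unit_ten A).trans (C.ten_unit A).symm) := by
  have hex := C.hexagon C.unit C.unit A
  rw [C.tHom_id_unit_left, C.tHom_id_unit_right,
    C.sw_eq_of_eq (C.unit_ten C.unit) A] at hex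
  simp only [C.comp_assoc, C.cHom_cHom, C.cHom_cHom_assoc] at hex
  have hsw := C.sw_comp_cancel (C.cHom_comp_cancel _ hex)
  rw [← C.comp_assoc] at hsw
  apply C.cHom_comp_cancel ((C.ten_unit A).trans (C.unit_ten A).symm)
  apply C.comp_cHom_cancel (congrArg (C.ten A ·) (C.unit_ten C.unit).symm)
  rw [hsw, C.cHom_cHom, C.cHom_cHom]

theorem sw_unit_right (A : C.Obj) :
    C.sw A C.unit = C.toSMCData.cHom ((C.ten_unit A).trans (C.unit_ten A).symm) := by
  apply C.sw_comp_cancel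
  rw [C.sw_sw, C.sw_unit_left, C.cHom_cHom, C.cHom_refl]

theorem cHom_comp_dR :
    C.comp (C.toSMCData.cHom (C.ten_unit (C.bang C.unit))) C.dR = C.der C.unit := by
  rw [dR, cHom, C.cHom_cHom_assoc, C.cHom_refl, C.id_comp]

theorem dcircR_comp_dR : C.comp C.dcircR C.dR = C.comp (C.dcirc C.unit) (C.der C.unit) := by
  rw [dcircR, cHom, C.comp_assoc, cHom_comp_dR]

/-- At the unit, the linear rule says that the derivative of `ε` is the counit. -/
theorem der_unit_eps :
    C.comp (C.der C.unit) (C.eps C.unit) =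
      C.comp (C.toSMCData.cHom (C.ten_unit (C.bang C.unit))) (C.cunit C.unit) := by
  rw [C.der_eps, C.tHom_id_unit_right]
  simp only [C.comp_assoc, C.cHom_cHom, C.cHom_refl, C.comp_id]

theorem tHom_der_unit_eps :
    C.tHom (C.der C.unit) (C.eps C.unit) =
      C.comp (C.toSMCData.cHom (congrArg (C.ten · (C.bang C.unit)) (C.ten_unit (C.bang C.unit))))
        (C.comp (C.tHom (C.id (C.bang C.unit)) (C.eps C.unit)) (C.tHom C.dR (C.id C.unit))) := by
  have hc := C.tHom_cHom (C.ten_unit (C.bang C.unit)) (rfl : C.bang C.unit = C.bang C.unit)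
  rw [← hc, C.cHom_refl, ← C.tHom_comp, ← C.tHom_comp, C.id_comp, C.id_comp, C.comp_id,
    cHom_comp_dR]

/-- The canonical commutation relation between `d` and `d°` at the unit. -/
theorem dR_comp_dcircR : C.comp C.dR C.dcircR = C.J C.unit := by
  have hswap : C.tHom (C.id (C.bang C.unit)) (C.sw (C.bang C.unit) C.unit) =
      C.toSMCData.cHom (congrArg (C.ten (C.bang C.unit) ·)
        ((C.ten_unit (C.bang C.unit)).trans (C.unit_ten (C.bang C.unit)).symm)) := by
    rw [sw_unit_right, ← C.cHom_refl rfl, C.tHom_cHom]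
  have hcunit : C.comp (C.tHom (C.id (C.bang C.unit)) (C.der C.unit))
        (C.tHom (C.id (C.bang C.unit)) (C.eps C.unit)) =
      C.comp (C.toSMCData.cHom (congrArg (C.ten (C.bang C.unit) ·) (C.ten_unit (C.bang C.unit))))
        (C.tHom (C.id (C.bang C.unit)) (C.cunit C.unit)) := by
    rw [← C.tHom_id_comp, der_unit_eps, C.tHom_id_comp]
    congr 1
    rw [← C.cHom_refl rfl, C.tHom_cHom]
  have hder : C.comp (C.tHom (C.der C.unit) (C.id (C.bang C.unit)))
      (C.tHom (C.id (C.bang C.unit)) (C.eps C.unit)) =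
      C.tHom (C.der C.unit) (C.eps C.unit) := by
    rw [← C.tHom_comp, C.id_comp, C.comp_id]
  rw [J, ← dcircR_comp_dR, dcircR, dcirc]
  nth_rw 1 [dR]
  simp only [cHom, C.comp_assoc]
  rw [← C.comp_assoc (C.der C.unit), C.der_cmul, C.add_comp, C.comp_add]
  congr 1
  · simp only [C.comp_assoc]
    rw [← C.comp_assoc (C.tHom (C.der C.unit) _), hder, hswap, tHom_der_unit_eps,
      C.tHom_id_unit_right (C.cmul C.unit), C.tHom_id_unit_right C.dR]
    simp only [C.comp_assoc, C.cHom_cHom, C.cHom_cHom_assoc, C.cHom_refl, C.id_comp, C.comp_id]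
  · simp only [C.comp_assoc]
    rw [← C.comp_assoc (C.tHom _ (C.der C.unit)), hcunit,
      C.tHom_id_unit_right (C.cmul C.unit)]
    simp only [C.comp_assoc, C.cHom_cHom_assoc, C.cHom_refl, C.id_comp]
    exact C.cmul_counit_right C.unit

theorem bangMap_zero_comp_dcircR :
    C.comp (C.bangMap (C.zero : C.Hom C.unit C.unit)) C.dcircR = C.zero := by
  rw [dcircR, dcirc, ← C.comp_assoc, ← C.comp_assoc, C.cmul_natural, C.comp_assoc (C.cmul _),
    ← C.tHom_comp, C.eps_natural, C.comp_zero, C.tHom_zero_right, C.comp_zero, C.zero_comp]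

end DiffCat

/-- Corollary: if J_R is an isomorphism and s_R := d°_R J_R⁻¹ satisfies
[ftc.2], then s_R is the unique map satisfying [ftc.2]. -/
theorem statement11 (C : DiffCat) (JRinv : C.Hom (C.bang C.unit) (C.bang C.unit))
    (hJ1 : C.comp (C.J C.unit) JRinv = C.id (C.bang C.unit))
    (hJ2 : C.comp JRinv (C.J C.unit) = C.id (C.bang C.unit))
    (hftc2 : C.add (C.comp (C.comp C.dcircR JRinv) C.dR)
        (C.bangMap (C.zero : C.Hom C.unit C.unit)) = C.id (C.bang C.unit)) :
    ∀ s' : C.Hom (C.bang C.unit) (C.bang C.unit),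
      C.add (C.comp s' C.dR) (C.bangMap (C.zero : C.Hom C.unit C.unit)) =
          C.id (C.bang C.unit) →
        s' = C.comp C.dcircR JRinv := by
  intro s' hs'
  have hsJ : C.comp s' (C.J C.unit) = C.dcircR := by
    have h := congrArg (C.comp · C.dcircR) hs'
    simpa only [C.add_comp, C.bangMap_zero_comp_dcircR, C.add_zero, C.comp_assoc,
      C.dR_comp_dcircR, C.id_comp] using h
  rw [← hsJ, C.comp_assoc, hJ1, C.comp_id]
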